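/- Let Δ be a pure simplicial complex on [n] and r ≥ 2. Then the maximal length of the j-th linear strands of the minimal graded free resolution of k[Δ] for j < r is at most n − S_r-depth(k[Δ]); that is, max{ i : β_{i,i+j}(k[Δ]) ≠ 0 for some j < r } ≤ n − S_r-depth(k[Δ]). -/

import Mathlib

/-!
Common definitions for formalizing "The Serre depth of Stanley–Reisner rings and
the depth of their symbolic powers" (Muta–Terai).
-/

open CategoryTheory MvPolynomial

noncomputable section

namespace SerrePaper

/-! ### Simplicial complexes (given by their sets of faces) -/

variable {V : Type}

/-- A (nonempty, downward closed) abstract simplicial complex, given by its set of faces. -/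
def IsComplex (K : Set (Finset V)) : Prop :=
  K.Nonempty ∧ ∀ F ∈ K, ∀ G ⊆ F, G ∈ K

/-- `F` is a facet (maximal face) of `K`. -/
def IsFacet (K : Set (Finset V)) (F : Finset V) : Prop :=
  F ∈ K ∧ ∀ G ∈ K, F ⊆ G → G = F

/-- `K` is pure: all facets have the same cardinality. -/
def Pure (K : Set (Finset V)) : Prop :=
  ∀ F G : Finset V, IsFacet K F → IsFacet K G → F.card = G.card

/-- `dim K = d - 1`, i.e. the maximal cardinality of a face of `K` is `d`. -/
def HasDimCard (K : Set (Finset V)) (d : ℕ) : Prop :=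
  (∃ F ∈ K, F.card = d) ∧ ∀ F ∈ K, F.card ≤ d

/-- the link of the face `F` in `K`. -/
def link [DecidableEq V] (K : Set (Finset V)) (F : Finset V) : Set (Finset V) :=
  { G | G ∪ F ∈ K ∧ G ∩ F = ∅ }

/-- `skeleton K t` is the `(t-1)`-skeleton `K^{t-1}` of `K`:
all faces with at most `t` vertices. -/
def skeleton (K : Set (Finset V)) (t : ℕ) : Set (Finset V) :=
  { F ∈ K | F.card ≤ t }

/-- The Alexander dual complex `K^∨ = { F | complement of F is not a face of K }`. -/
def dualComplex [Fintype V] [DecidableEq V] (K : Set (Finset V)) : Set (Finset V) :=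
  { F | Fᶜ ∉ K }

/-- The copy of `K` on its own vertex set (as a complex on the corresponding subtype). -/
def restrictVerts (K : Set (Finset V)) : Set (Finset {v : V // {v} ∈ K}) :=
  { F | F.map (Function.Embedding.subtype _) ∈ K }

/-- The induced subcomplex `K_W` on a subset `W` of the vertices. -/
def inducedSub (K : Set (Finset V)) (W : Finset V) : Set (Finset V) :=
  { F ∈ K | F ⊆ W }

/-- `K` is a matroid complex: every induced subcomplex is pure. -/
def IsMatroidComplex (K : Set (Finset V)) : Prop :=
  ∀ W : Finset V, Pure (inducedSub K W)

/-! ### Reduced simplicial homology with coefficients in a field `k` -/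

/-- The group of simplicial `(c-1)`-chains: formal `k`-linear combinations of the
faces of `K` with exactly `c` vertices. -/
abbrev chainGroup (k : Type) [Field k] (K : Set (Finset V)) (c : ℕ) : Type :=
  {F : Finset V // F ∈ K ∧ F.card = c} →₀ k

open Classical in
/-- the boundary of a single face, `∂F = ∑_{x ∈ F} (-1)^{pos of x in F} (F \ {x})`. -/
def boundaryAt (k : Type) [Field k] [LinearOrder V] (K : Set (Finset V)) (c : ℕ)
    (F : {F : Finset V // F ∈ K ∧ F.card = c + 1}) : chainGroup k K c :=
  ∑ x ∈ F.1.attach,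
    if h : F.1.erase x.1 ∈ K then
      Finsupp.single
        ⟨F.1.erase x.1, h, by simp [Finset.card_erase_of_mem x.2, F.2.2]⟩
        ((-1 : k) ^ (F.1.filter (fun y => y < x.1)).card)
    else 0

/-- The simplicial boundary map (for a downward closed `K` this is the usual
boundary map of the reduced (augmented) chain complex of `K`, where faces with
`c` vertices sit in homological degree `c - 1`). -/
def boundary (k : Type) [Field k] [LinearOrder V] (K : Set (Finset V)) (c : ℕ) :
    chainGroup k K (c + 1) →ₗ[k] chainGroup k K c :=
  Finsupp.lsum k fun F => LinearMap.toSpanSingleton k _ (boundaryAt k K c F)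

/-- `H̃ᵢ(K; k) = 0`: every reduced `i`-cycle is a boundary.  (For `i ≤ -2` this holds
trivially; for `i = -1` the relevant cycle group is the whole of the `(-1)`-chains.) -/
def reducedHomologyVanishes (k : Type) [Field k] [LinearOrder V]
    (K : Set (Finset V)) (i : ℤ) : Prop :=
  if i < -1 then True
  else if i = -1 then
    ∀ z : chainGroup k K 0, ∃ b : chainGroup k K 1, boundary k K 0 b = z
  else
    ∀ z : chainGroup k K (i.toNat + 1), boundary k K i.toNat z = 0 →
      ∃ b : chainGroup k K (i.toNat + 2), boundary k K (i.toNat + 1) b = z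

/-- Nonvanishing `β_{i,j}(k[K]) ≠ 0` of the graded Betti numbers of the
Stanley–Reisner ring of `K`, expressed via Hochster's formula:
`β_{i,j}(k[K]) = ∑_{W ⊆ V, |W| = j} dim_k H̃_{j-i-1}(K_W; k)`. -/
def bettiNonzero (k : Type) [Field k] [LinearOrder V] (K : Set (Finset V)) (i j : ℕ) : Prop :=
  ∃ W : Finset V, W.card = j ∧
    ¬ reducedHomologyVanishes k (inducedSub K W) ((j : ℤ) - i - 1)

/-- `reg_{≤ r} I_K = max{ j : β_{i,i+j}(I_K) ≠ 0 for some i ≤ r }`, where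
`β_{i,d}(I_K) = β_{i+1,d}(k[K])`. -/
def regLEIdeal (k : Type) [Field k] [LinearOrder V] (K : Set (Finset V)) (r : ℕ) : ℕ :=
  sSup { j : ℕ | ∃ i ≤ r, bettiNonzero k K (i + 1) (i + j) }

/-- `indeg I_K`: the least degree of a minimal generator of the Stanley–Reisner
ideal of `K`, i.e. `min{ j : β_{0,j}(I_K) = β_{1,j}(k[K]) ≠ 0 }`. -/
def indegIdeal (k : Type) [Field k] [LinearOrder V] (K : Set (Finset V)) : ℕ :=
  sInf { j : ℕ | bettiNonzero k K 1 j }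

/-! ### Stanley–Reisner rings, Serre depth, depth, symbolic powers -/

variable (k : Type) [Field k]

/-- The Stanley–Reisner ideal of `K` (generated by the monomials of the non-faces,
equivalently by those of the minimal non-faces). -/
def srIdeal (K : Set (Finset V)) : Ideal (MvPolynomial V k) :=
  Ideal.span { m | ∃ F : Finset V, F ∉ K ∧ m = ∏ i ∈ F, X i }

/-- The homogeneous maximal ideal `(x_v : v ∈ V)` of the polynomial ring. -/
def maxIdeal (V : Type) : Ideal (MvPolynomial V k) :=
  Ideal.span (Set.range X)

/-- The quotient ring `S/I` as an object of `ModuleCat S`. -/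
def quotMod {V : Type} (I : Ideal (MvPolynomial V k)) : ModuleCat (MvPolynomial V k) :=
  ModuleCat.of _ (MvPolynomial V k ⧸ I)

/-- The Stanley–Reisner ring `k[K] = S/I_K` as a module over `S`. -/
def srRing (K : Set (Finset V)) : ModuleCat (MvPolynomial V k) :=
  quotMod k (srIdeal k K)

/-- The Krull dimension of a module, `dim M = dim (R / ann M)` (so `dim 0 = ⊥ = -∞`). -/
def modDim {R : Type} [CommRing R] (M : ModuleCat R) : WithBot ℕ∞ :=
  ringKrullDim (R ⧸ Module.annihilator R M)

/-- `Ext_R^i(M, N)` as an `R`-module. -/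
def extM {R : Type} [CommRing R] (M N : ModuleCat R) (i : ℕ) : ModuleCat R :=
  ((Ext R (ModuleCat R) i).obj (Opposite.op M)).obj N

/-- `K_M^j = Ext_S^{n-j}(M, ω_S)`, the (Matlis dual of) local cohomology; since the
canonical module `ω_S` of the polynomial ring `S` is `S` itself up to a
grading shift, we use `Ext_S^{n-j}(M, S)`. -/
def serreK {V : Type} (M : ModuleCat (MvPolynomial V k)) (j : ℕ) :
    ModuleCat (MvPolynomial V k) :=
  extM M (ModuleCat.of _ (MvPolynomial V k)) (Nat.card V - j)

/-- The Serre depth `S_r-depth(M) = min{ j : dim K_M^j ≥ j - r + 1 }`.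
(Note that, since `dim K_M^j` is either `⊥` or `≥ 0`, the inequality
`dim K_M^j ≥ j - r + 1` of (possibly negative) integers is equivalent to
`(j + 1 - r : ℕ) ≤ dim K_M^j` with truncated subtraction.) -/
def serreDepth {V : Type} (r : ℕ) (M : ModuleCat (MvPolynomial V k)) : ℕ :=
  sInf { j : ℕ | ((j + 1 - r : ℕ) : WithBot ℕ∞) ≤ modDim (serreK k M j) }

/-- Serre's condition `(S_r)` for an unmixed module: `S_r-depth(M) = dim M`. -/
def serreCond {V : Type} (r : ℕ) (M : ModuleCat (MvPolynomial V k)) : Prop :=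
  (serreDepth k r M : WithBot ℕ∞) = modDim M

/-- The depth of `M` with respect to the homogeneous maximal ideal,
via Rees' characterization `depth M = min{ i : Ext^i(S/m, M) ≠ 0 }`. -/
def mdepth {V : Type} (M : ModuleCat (MvPolynomial V k)) : ℕ :=
  sInf { i : ℕ | Nontrivial (extM (quotMod k (maxIdeal k V)) M i) }

/-- `M` is Cohen–Macaulay: `depth M = dim M`. -/
def isCM {V : Type} (M : ModuleCat (MvPolynomial V k)) : Prop :=
  (mdepth k M : WithBot ℕ∞) = modDim M

/-- The `ℓ`-th symbolic power of a (radical, e.g. squarefree monomial) ideal: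
`I^(ℓ) = ⋂_{P ∈ Min(I)} P^ℓ`. -/
def symbPow {R : Type} [CommRing R] (I : Ideal R) (ℓ : ℕ) : Ideal R :=
  sInf { J | ∃ P ∈ I.minimalPrimes, J = P ^ ℓ }

/-- The height of an ideal: the Krull dimension of the poset of primes contained in it. -/
def idealHeight {R : Type} [CommRing R] (p : Ideal R) : WithBot ℕ∞ :=
  Order.krullDim { q : PrimeSpectrum R // q.asIdeal ≤ p }

/-- `R/I` is unmixed: all associated primes of `R/I` have the same height. -/
def IsUnmixedIdeal {R : Type} [CommRing R] (I : Ideal R) : Prop :=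
  ∀ p q : Ideal R, p ∈ associatedPrimes R (R ⧸ I) → q ∈ associatedPrimes R (R ⧸ I) →
    idealHeight p = idealHeight q

/-- Nonvanishing of the first local cohomology `H_m^1(S/I) ≠ 0`. -/
def H1NE {V : Type} (I : Ideal (MvPolynomial V k)) : Prop :=
  Nontrivial ((localCohomology (maxIdeal k V) 1).obj (quotMod k I))

/-- `I` is a squarefree monomial ideal. -/
def IsSqFreeMonomialIdeal {V : Type} (I : Ideal (MvPolynomial V k)) : Prop :=
  ∃ G : Set (Finset V), I = Ideal.span ((fun F => ∏ i ∈ F, X i) '' G)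

end SerrePaper

end
namespace SerrePaper

/-! ### A free resolution of the Stanley–Reisner ring

The modules are free on the pairs `(A, B)` of disjoint sets with `B` a face of `K`, the homological
degree is the cardinality of `A`, and the augmentation maps `(∅, B)` to `∏ b ∈ B, X b`. A nonzero
homology class of the link of a face `F` gives a cocycle on the dual of this resolution, whose class
in `Ext` is only annihilated by polynomials in the ideal of the variables outside `F`. -/

section Resolution

variable {V : Type} [LinearOrder V]

/-- The sign `(-1)^p`, where `p` is the number of elements of `A` preceding `a`. -/
def positionSign (R : Type) [CommRing R] (A : Finset V) (a : V) : R :=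
  (-1) ^ (A.filter (· < a)).card

section Sign

variable (R : Type) [CommRing R]

theorem positionSign_mul_self (A : Finset V) (a : V) :
    positionSign R A a * positionSign R A a = 1 := by
  rw [positionSign, ← mul_pow]; simp

theorem positionSign_erase_of_lt {A : Finset V} {a b : V} (hb : b ∈ A) (h : b < a) :
    positionSign R (A.erase b) a = -positionSign R A a := by
  have hb' : b ∈ A.filter (· < a) := by simp [hb, h]
  rw [positionSign, positionSign, Finset.filter_erase, ← Finset.card_erase_add_one hb', pow_succ]
  ring

theorem positionSign_erase_of_not_lt {A : Finset V} {a b : V} (h : ¬ b < a) :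
    positionSign R (A.erase b) a = positionSign R A a := by
  rw [positionSign, positionSign, Finset.filter_erase, Finset.erase_eq_of_notMem (by simp [h])]

theorem positionSign_erase_self (A : Finset V) (a : V) :
    positionSign R (A.erase a) a = positionSign R A a :=
  positionSign_erase_of_not_lt R (lt_irrefl a)

theorem positionSign_mul_positionSign_erase {A : Finset V} {a b : V} (hab : a ≠ b)
    (ha : a ∈ A) (hb : b ∈ A) :
    positionSign R A a * positionSign R (A.erase a) b =
      -(positionSign R A b * positionSign R (A.erase b) a) := by
  rcases lt_or_gt_of_ne hab with h | h
  · rw [positionSign_erase_of_lt R ha h, positionSign_erase_of_not_lt R h.not_gt]; ring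
  · rw [positionSign_erase_of_lt R hb h, positionSign_erase_of_not_lt R h.not_gt]; ring

theorem positionSign_insert_mul {A : Finset V} {a s : V} (ha : a ∈ A) (hs : s ∉ A) :
    positionSign R A s * positionSign R (insert s A) a =
      -(positionSign R A a * positionSign R (A.erase a) s) := by
  have has : s ≠ a := by rintro rfl; exact hs ha
  have h := positionSign_mul_positionSign_erase R (A := insert s A) has
    (Finset.mem_insert_self s A) (Finset.mem_insert_of_mem ha)
  rw [Finset.erase_insert hs] at h
  have h1 : positionSign R (insert s A) s = positionSign R A s := by
    rw [← positionSign_erase_self, Finset.erase_insert hs]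
  have h2 : positionSign R ((insert s A).erase a) s = positionSign R (A.erase a) s := by
    rw [← positionSign_erase_self, Finset.erase_right_comm, Finset.erase_insert hs]
  rw [h1, h2] at h
  rcases lt_or_gt_of_ne has with hlt | hlt
  · have : positionSign R (insert s A) a = - positionSign R A a := by
      have := positionSign_erase_of_lt R (Finset.mem_insert_self s A) hlt
      rw [Finset.erase_insert hs] at this
      rw [this]; ring
    rw [this, positionSign_erase_of_not_lt R hlt.not_gt]; ring
  · have : positionSign R (insert s A) a = positionSign R A a := by
      have := positionSign_erase_of_not_lt R (A := insert s A) (b := s) hlt.not_gt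
      rw [Finset.erase_insert hs] at this
      rw [this]
    rw [this, positionSign_erase_of_lt R ha hlt]; ring

end Sign

variable (k : Type) [Field k]

/-- The free module over `k[x_v : v ∈ V]` on all pairs `(A, B)` of finite subsets of `V`. -/
abbrev PairModule (V : Type) : Type := (Finset V × Finset V) →₀ MvPolynomial V k

open Classical in
/-- The operator `(A, B) ↦ ±(x_a (A \ a, B) - (A \ a, B ∪ a))` for `a ∈ A`, where the second
summand is dropped if `B ∪ a` is not a face of `K`. -/
noncomputable def vertexDifferential (K : Set (Finset V)) (a : V) :
    PairModule k V →ₗ[MvPolynomial V k] PairModule k V :=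
  Finsupp.lsum (MvPolynomial V k) fun p => LinearMap.toSpanSingleton _ _
    (if a ∈ p.1 then
      Finsupp.single (p.1.erase a, p.2) (positionSign _ p.1 a * X a) -
        if insert a p.2 ∈ K then
          Finsupp.single (p.1.erase a, insert a p.2) (positionSign _ p.1 a) else 0
    else 0)

open Classical in
/-- The map `g (A, B) ↦ ± (g / x_s) (A ∪ s, B)` for `s ∉ A ∪ B`. -/
noncomputable def vertexHomotopy (s : V) : PairModule k V →+ PairModule k V :=
  Finsupp.liftAddHom fun p =>
    if s ∉ p.1 ∧ s ∉ p.2 then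
      (Finsupp.singleAddHom (insert s p.1, p.2)).comp
        { toFun := fun g => positionSign _ p.1 s * divMonomial g (Finsupp.single s 1)
          map_zero' := by simp
          map_add' := fun g h => by rw [add_divMonomial, mul_add] }
    else 0

variable {k}
variable {K : Set (Finset V)}

open Classical in
theorem vertexDifferential_single (a : V) (A B : Finset V) (g : MvPolynomial V k) :
    vertexDifferential k K a (Finsupp.single (A, B) g) =
      if a ∈ A then
        Finsupp.single (A.erase a, B) (positionSign _ A a * X a * g) -
          if insert a B ∈ K then
            Finsupp.single (A.erase a, insert a B) (positionSign _ A a * g) else 0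
      else 0 := by
  rw [vertexDifferential, Finsupp.lsum_single, LinearMap.toSpanSingleton_apply]
  split_ifs <;> simp [smul_sub, mul_comm g, -Finsupp.single_mul]

open Classical in
theorem vertexHomotopy_single (s : V) (A B : Finset V) (g : MvPolynomial V k) :
    vertexHomotopy k s (Finsupp.single (A, B) g) =
      if s ∉ A ∧ s ∉ B then
        Finsupp.single (insert s A, B)
          (positionSign _ A s * divMonomial g (Finsupp.single s 1)) else 0 := by
  rw [vertexHomotopy, Finsupp.liftAddHom_apply_single]
  split_ifs <;> simp

theorem vertexDifferential_self (a : V) (z : PairModule k V) :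
    vertexDifferential k K a (vertexDifferential k K a z) = 0 := by
  classical
  induction z using Finsupp.induction_linear with
  | zero => simp
  | add f g hf hg => rw [map_add, map_add, hf, hg, add_zero]
  | single p g =>
    obtain ⟨A, B⟩ := p
    rw [vertexDifferential_single]
    split_ifs <;> simp [vertexDifferential_single, -Finsupp.single_mul]

theorem vertexDifferential_anticomm (hK : ∀ F ∈ K, ∀ G ⊆ F, G ∈ K) {a b : V} (hab : a ≠ b)
    (z : PairModule k V) :
    vertexDifferential k K a (vertexDifferential k K b z) =
      -vertexDifferential k K b (vertexDifferential k K a z) := by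
  classical
  induction z using Finsupp.induction_linear with
  | zero => simp
  | add f g hf hg => simp only [map_add, hf, hg, neg_add]
  | single p g =>
    obtain ⟨A, B⟩ := p
    by_cases ha : a ∈ A
    swap
    · rw [vertexDifferential_single a, if_neg ha, vertexDifferential_single b]
      split_ifs <;> simp [vertexDifferential_single, ha, -Finsupp.single_mul]
    by_cases hb : b ∈ A
    swap
    · rw [vertexDifferential_single a, vertexDifferential_single b, if_neg hb]
      split_ifs <;> simp [vertexDifferential_single, hb, -Finsupp.single_mul]
    have hs := positionSign_mul_positionSign_erase (MvPolynomial V k) hab ha hb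
    have hba : b ∈ A.erase a := Finset.mem_erase.2 ⟨hab.symm, hb⟩
    have hab' : a ∈ A.erase b := Finset.mem_erase.2 ⟨hab, ha⟩
    have h1 : insert a (insert b B) ∈ K → insert a B ∈ K := fun h =>
      hK _ h _ (Finset.insert_subset_insert _ (Finset.subset_insert _ _))
    have h2 : insert a (insert b B) ∈ K → insert b B ∈ K := fun h =>
      hK _ h _ (Finset.subset_insert _ _)
    have e1 : (A.erase b).erase a = (A.erase a).erase b := Finset.erase_right_comm
    have e2 : insert b (insert a B) = insert a (insert b B) := Finset.insert_comm _ _ _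
    have k1 : ∀ y : MvPolynomial V k,
        positionSign (MvPolynomial V k) (A.erase b) a * (positionSign _ A b * y) =
        -(positionSign (MvPolynomial V k) (A.erase a) b * (positionSign _ A a * y)) := by
      intro y; linear_combination y * hs
    by_cases h3 : insert a (insert b B) ∈ K
    · simp only [vertexDifferential_single, ha, hb, if_true, h1 h3, h2 h3, map_sub, hba, hab', e1,
        e2, h3, mul_assoc, mul_left_comm (X _) (positionSign _ _ _), k1, Finsupp.single_neg,
        mul_left_comm (X b) (X a)]
      abel
    · by_cases h4 : insert a B ∈ K <;> by_cases h5 : insert b B ∈ K <;>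
      simp only [vertexDifferential_single, ha, hb, if_true, h4, h5, map_sub, hba, hab', e1,
        e2, h3, mul_assoc, mul_left_comm (X _) (positionSign _ _ _), k1, Finsupp.single_neg,
        mul_left_comm (X b) (X a), if_false, map_zero] <;>
      abel

theorem X_mul_divMonomial_single_of_ne {a s : V} (h : a ≠ s) (g : MvPolynomial V k) :
    divMonomial (X a * g) (Finsupp.single s 1) = X a * divMonomial g (Finsupp.single s 1) := by
  classical
  ext m
  rw [coeff_divMonomial, coeff_X_mul', coeff_X_mul', coeff_divMonomial]
  have : a ∈ (Finsupp.single s 1 + m).support ↔ a ∈ m.support := by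
    simp [h.symm]
  simp only [this]
  split_ifs with ha
  · congr 1
    rw [add_tsub_assoc_of_le]
    rw [Finsupp.single_le_iff]
    have := Finsupp.mem_support_iff.1 ha
    omega
  · rfl

theorem vertexHomotopy_anticomm {a s : V} (h : a ≠ s) (z : PairModule k V) :
    vertexDifferential k K a (vertexHomotopy k s z) =
      -vertexHomotopy k s (vertexDifferential k K a z) := by
  classical
  induction z using Finsupp.induction_linear with
  | zero => simp
  | add f g hf hg => simp only [map_add, hf, hg, neg_add]
  | single p g =>
    obtain ⟨A, B⟩ := p
    by_cases hs : s ∉ A ∧ s ∉ B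
    swap
    · have hs' : ¬ (s ∉ A.erase a ∧ s ∉ B) := by simpa [h.symm] using hs
      have hs'' : ¬ (s ∉ A.erase a ∧ s ∉ insert a B) := by simpa [h.symm] using hs
      rw [vertexHomotopy_single, if_neg hs, vertexDifferential_single]
      split_ifs <;> simp [vertexHomotopy_single, hs', hs'', -Finset.mem_erase, -Finset.mem_insert,
        -Finsupp.single_mul]
    have hs' : s ∉ A.erase a ∧ s ∉ B := by simpa [h.symm] using hs
    have hs'' : s ∉ A.erase a ∧ s ∉ insert a B := by simpa [h.symm] using hs
    rw [vertexHomotopy_single, if_pos hs, vertexDifferential_single, vertexDifferential_single]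
    by_cases ha : a ∈ A
    swap
    · simp [ha, h]
    have hC : ∀ (T : Finset V) (b : V) (y : MvPolynomial V k),
        divMonomial (positionSign _ T b * y) (Finsupp.single s 1) =
          positionSign _ T b * divMonomial y (Finsupp.single s 1) := by
      intro T b y
      rcases neg_one_pow_eq_or (MvPolynomial V k) (T.filter (· < b)).card with e | e <;>
        rw [positionSign, e]
      · simp
      · ext m; simp [coeff_divMonomial]
    have hsg := positionSign_insert_mul (MvPolynomial V k) ha hs.1
    have k1 : ∀ y : MvPolynomial V k,
        positionSign (MvPolynomial V k) (insert s A) a * (positionSign _ A s * y) =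
        -(positionSign (MvPolynomial V k) (A.erase a) s * (positionSign _ A a * y)) := by
      intro y; linear_combination y * hsg
    have e1 : (insert s A).erase a = insert s (A.erase a) :=
      Finset.erase_insert_of_ne h.symm
    rw [if_pos (Finset.mem_insert_of_mem ha), if_pos ha]
    by_cases hB : insert a B ∈ K <;>
    simp only [hB, if_true, if_false, map_sub, vertexHomotopy_single, hs', hs'', e1, mul_assoc, hC,
      X_mul_divMonomial_single_of_ne h, mul_left_comm (X _) (positionSign _ _ _), k1,
      Finsupp.single_neg, map_zero, not_false_eq_true, and_self] <;> abel

theorem vertexHomotopy_single_apply {s : V} {p : Finset V × Finset V} (hp : ¬ (s ∈ p.1 ∧ s ∈ p.2))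
    {A : Finset V} (h : s ∈ A ∨ p.1 ≠ A) (B : Finset V) (g : MvPolynomial V k) :
    (vertexDifferential k K s (vertexHomotopy k s (Finsupp.single p g)) +
      vertexHomotopy k s (vertexDifferential k K s (Finsupp.single p g))) (A, B) =
      Finsupp.single p g (A, B) := by
  classical
  obtain ⟨A', B'⟩ := p
  by_cases hA : s ∈ A'
  · have hB : s ∉ B' := fun hB => hp ⟨hA, hB⟩
    have h1 : divMonomial (positionSign _ A' s * X s * g) (Finsupp.single s 1) =
        positionSign _ A' s * g := by
      rw [mul_right_comm, mul_comm _ (X s), X_mul_divMonomial]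
    have h2 : ∀ y : MvPolynomial V k, positionSign _ A' s * (positionSign _ A' s * y) = y := by
      intro y; rw [← mul_assoc, positionSign_mul_self, one_mul]
    rw [vertexHomotopy_single, if_neg (by simp [hA]), vertexDifferential_single, if_pos hA,
      map_zero, zero_add, map_sub, vertexHomotopy_single, if_pos (by simp [hB]), h1, positionSign_erase_self,
      h2, Finset.insert_erase hA]
    split_ifs <;> simp [vertexHomotopy_single, -Finsupp.single_mul]
  · have hAA : A' ≠ A := h.elim (fun hs e => hA (e ▸ hs)) id
    rw [vertexDifferential_single, if_neg hA, map_zero, add_zero, vertexHomotopy_single]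
    split_ifs
    · rw [vertexDifferential_single, if_pos (Finset.mem_insert_self s A'), Finset.erase_insert hA]
      split_ifs <;> simp [hAA, -Finsupp.single_mul]
    · simp [hAA]

theorem vertexHomotopy_apply {s : V} {z : PairModule k V}
    (hz : ∀ A B, z (A, B) ≠ 0 → ¬ (s ∈ A ∧ s ∈ B)) {A : Finset V}
    (h : s ∈ A ∨ ∀ C, z (A, C) = 0) (B : Finset V) :
    (vertexDifferential k K s (vertexHomotopy k s z) +
      vertexHomotopy k s (vertexDifferential k K s z)) (A, B) = z (A, B) := by
  have key : ∀ p ∈ z.support,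
      (vertexDifferential k K s (vertexHomotopy k s (Finsupp.single p (z p))) +
      vertexHomotopy k s (vertexDifferential k K s (Finsupp.single p (z p)))) (A, B) =
      Finsupp.single p (z p) (A, B) := fun p hp => by
    have hp := Finsupp.mem_support_iff.1 hp
    refine vertexHomotopy_single_apply (hz _ _ hp) (h.imp_right fun h' e => hp ?_) B _
    rw [← h' p.2, ← e]
  conv_lhs => rw [← Finsupp.sum_single z]
  conv_rhs => rw [← Finsupp.sum_single z]
  simp only [Finsupp.sum, map_sum, Finsupp.add_apply, Finsupp.finsetSum_apply] at key ⊢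
  rw [← Finset.sum_add_distrib]
  exact Finset.sum_congr rfl key

variable [Fintype V]

variable (k K) in
/-- The differential of the resolution of `k[K]`. -/
noncomputable def pairDifferential : PairModule k V →ₗ[MvPolynomial V k] PairModule k V :=
  ∑ a, vertexDifferential k K a

theorem pairDifferential_comp_self (hK : ∀ F ∈ K, ∀ G ⊆ F, G ∈ K) (z : PairModule k V) :
    pairDifferential k K (pairDifferential k K z) = 0 := by
  simp only [pairDifferential, LinearMap.sum_apply, map_sum]
  rw [← Finset.sum_product']
  refine Finset.sum_involution (fun p _ => p.swap) ?_ ?_ (by simp) (by simp)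
  · rintro ⟨a, b⟩ -
    by_cases hab : a = b
    · subst hab; simp [vertexDifferential_self]
    · simp [vertexDifferential_anticomm hK hab]
  · rintro ⟨a, b⟩ - hne hab
    obtain rfl : b = a := congrArg Prod.fst hab
    exact hne (vertexDifferential_self _ _)

variable (K) in
/-- The pairs `(A, B)` indexing the basis of the resolution of `k[K]` in degree `i`. -/
def degreePairs (i : ℕ) : Set (Finset V × Finset V) :=
  {p | p.1.card = i ∧ Disjoint p.1 p.2 ∧ p.2 ∈ K}

variable (k K) in
/-- The degree `i` part of the resolution of `k[K]`. -/
noncomputable abbrev degreeModule (i : ℕ) : Submodule (MvPolynomial V k) (PairModule k V) :=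
  Finsupp.supported _ _ (degreePairs K i)

omit [LinearOrder V] [Fintype V] in
theorem mem_degreeModule_iff {i : ℕ} {z : PairModule k V} :
    z ∈ degreeModule k K i ↔ ∀ A B, z (A, B) ≠ 0 → A.card = i ∧ Disjoint A B ∧ B ∈ K := by
  simp only [Finsupp.mem_supported, Set.subset_def, Finset.mem_coe, Finsupp.mem_support_iff,
    Prod.forall, degreePairs, Set.mem_ofPred_eq]

omit [LinearOrder V] [Fintype V] in
theorem map_mem_degreeModule {i j : ℕ} (L : PairModule k V →+ PairModule k V)
    (hL : ∀ A B g, A.card = i → Disjoint A B → B ∈ K →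
      L (Finsupp.single (A, B) g) ∈ degreeModule k K j) {z : PairModule k V}
    (hz : z ∈ degreeModule k K i) : L z ∈ degreeModule k K j := by
  rw [← Finsupp.sum_single z, Finsupp.sum, map_sum]
  refine Submodule.sum_mem _ fun p hp => ?_
  obtain ⟨h1, h2, h3⟩ := mem_degreeModule_iff.1 hz p.1 p.2 (Finsupp.mem_support_iff.1 hp)
  exact hL _ _ _ h1 h2 h3

theorem pairDifferential_mem {i : ℕ} {z : PairModule k V} (hz : z ∈ degreeModule k K (i + 1)) :
    pairDifferential k K z ∈ degreeModule k K i := by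
  classical
  refine map_mem_degreeModule (pairDifferential k K).toAddMonoidHom ?_ hz
  intro A B g hA hAB hB
  simp only [LinearMap.toAddMonoidHom_coe, pairDifferential, LinearMap.sum_apply]
  refine Submodule.sum_mem _ fun a _ => ?_
  rw [vertexDifferential_single]
  split_ifs with ha haB
  · refine Submodule.sub_mem _ (Finsupp.single_mem_supported _ _ ?_)
      (Finsupp.single_mem_supported _ _ ?_)
    · exact ⟨by simp [Finset.card_erase_of_mem ha, hA], hAB.mono_left (Finset.erase_subset _ _), hB⟩
    · refine ⟨by simp [Finset.card_erase_of_mem ha, hA], ?_, haB⟩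
      simp only [Finset.disjoint_insert_right, Finset.notMem_erase, not_false_eq_true, true_and]
      exact hAB.mono_left (Finset.erase_subset _ _)
  · rw [sub_zero]
    refine Finsupp.single_mem_supported _ _ ?_
    exact ⟨by simp [Finset.card_erase_of_mem ha, hA], hAB.mono_left (Finset.erase_subset _ _), hB⟩
  · exact Submodule.zero_mem _

omit [Fintype V] in
theorem vertexHomotopy_mem (s : V) {i : ℕ} {z : PairModule k V} (hz : z ∈ degreeModule k K i) :
    vertexHomotopy k s z ∈ degreeModule k K (i + 1) := by
  classical
  refine map_mem_degreeModule _ ?_ hz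
  intro A B g hA hAB hB
  rw [vertexHomotopy_single]
  split_ifs with h
  · exact Finsupp.single_mem_supported _ _
      ⟨by simp [Finset.card_insert_of_notMem h.1, hA], by simp [h.2, hAB], hB⟩
  · exact Submodule.zero_mem _

theorem pairDifferential_vertexHomotopy_add (s : V) (z : PairModule k V) :
    pairDifferential k K (vertexHomotopy k s z) + vertexHomotopy k s (pairDifferential k K z) =
      vertexDifferential k K s (vertexHomotopy k s z) +
        vertexHomotopy k s (vertexDifferential k K s z) := by
  simp only [pairDifferential, LinearMap.sum_apply, map_sum]
  rw [← Finset.sum_add_distrib]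
  refine Finset.sum_eq_single s (fun a _ ha => ?_) (by simp)
  rw [vertexHomotopy_anticomm ha, neg_add_cancel]

theorem exists_homologous_supported_compl {i : ℕ} {z : PairModule k V}
    (hK : ∀ F ∈ K, ∀ G ⊆ F, G ∈ K)
    (hz : z ∈ degreeModule k K i) (hdz : pairDifferential k K z = 0) (T : Finset V) :
    ∃ y ∈ degreeModule k K (i + 1), ∀ A B, ¬ Disjoint A T →
      (z - pairDifferential k K y) (A, B) = 0 := by
  classical
  induction T using Finset.induction_on with
  | empty => exact ⟨0, Submodule.zero_mem _, by simp⟩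
  | insert s T _ ih =>
    obtain ⟨y, hy, h⟩ := ih
    set w := z - pairDifferential k K y with hw
    have hwm : w ∈ degreeModule k K i := Submodule.sub_mem _ hz (pairDifferential_mem hy)
    have hdw : pairDifferential k K w = 0 := by
      rw [hw, map_sub, hdz, pairDifferential_comp_self hK, sub_zero]
    refine ⟨y + vertexHomotopy k s w, Submodule.add_mem _ hy (vertexHomotopy_mem s hwm), ?_⟩
    intro A B hA
    have h1 := pairDifferential_vertexHomotopy_add (K := K) s w
    rw [hdw, map_zero, add_zero] at h1
    rw [map_add, ← sub_sub, ← hw, h1, Finsupp.sub_apply, vertexHomotopy_apply, sub_self]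
    · intro A B hne hs
      exact Finset.disjoint_left.1 (mem_degreeModule_iff.1 hwm A B hne).2.1 hs.1 hs.2
    · rw [Finset.disjoint_insert_right, not_and_or, not_not] at hA
      exact hA.imp_right fun hA C => h A C hA

theorem exists_pairDifferential_eq {i : ℕ} {z : PairModule k V} (hK : ∀ F ∈ K, ∀ G ⊆ F, G ∈ K)
    (hz : z ∈ degreeModule k K (i + 1)) (hdz : pairDifferential k K z = 0) :
    ∃ y ∈ degreeModule k K (i + 2), pairDifferential k K y = z := by
  classical
  obtain ⟨y, hy, h⟩ := exists_homologous_supported_compl hK hz hdz Finset.univ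
  refine ⟨y, hy, (sub_eq_zero.1 (Finsupp.ext ?_)).symm⟩
  rintro ⟨A, B⟩
  by_cases hA : Disjoint A Finset.univ
  · by_contra hne
    have := (mem_degreeModule_iff.1 (Submodule.sub_mem _ hz (pairDifferential_mem hy)) A B hne).1
    rw [disjoint_self.1 (hA.mono_right (Finset.subset_univ A))] at this
    simp at this
  · exact h A B hA

variable (V k) in
/-- The augmentation of the resolution of `k[K]`, sending `(∅, B)` to `x^B`. -/
noncomputable def pairAugmentation : PairModule k V →ₗ[MvPolynomial V k] MvPolynomial V k :=
  Finsupp.lsum (MvPolynomial V k) fun p => LinearMap.toSpanSingleton _ _ (∏ b ∈ p.2, X b)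

omit [Fintype V] [LinearOrder V] in
theorem pairAugmentation_single (A B : Finset V) (g : MvPolynomial V k) :
    pairAugmentation V k (Finsupp.single (A, B) g) = g * ∏ b ∈ B, X b := by
  simp [pairAugmentation]

theorem pairAugmentation_pairDifferential_mem {i : ℕ} {z : PairModule k V}
    (hz : z ∈ degreeModule k K i) :
    pairAugmentation V k (pairDifferential k K z) ∈ srIdeal k K := by
  classical
  rw [← Finsupp.sum_single z, Finsupp.sum]
  simp only [map_sum, pairDifferential, LinearMap.sum_apply]
  refine Submodule.sum_mem _ fun p hp => Submodule.sum_mem _ fun a _ => ?_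
  obtain ⟨-, hd, -⟩ := mem_degreeModule_iff.1 hz p.1 p.2 (Finsupp.mem_support_iff.1 hp)
  rw [show p = (p.1, p.2) from rfl, vertexDifferential_single]
  split_ifs with ha haK
  · rw [map_sub, pairAugmentation_single, pairAugmentation_single,
      Finset.prod_insert (Finset.disjoint_left.1 hd ha)]
    convert Submodule.zero_mem _ using 1
    ring
  · rw [sub_zero, pairAugmentation_single]
    have : (∏ b ∈ insert a p.2, X b : MvPolynomial V k) ∈ srIdeal k K :=
      Ideal.subset_span ⟨_, haK, rfl⟩
    rw [Finset.prod_insert (Finset.disjoint_left.1 hd ha)] at this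
    convert Ideal.mul_mem_left _ (positionSign _ p.1 a * z p) this using 1
    ring
  · rw [map_zero]; exact Submodule.zero_mem _

open Classical in
theorem single_prod_sub_mem_map_pairDifferential (h0 : ∅ ∈ K)
    (hK : ∀ F ∈ K, ∀ G ⊆ F, G ∈ K) (C : Finset V) :
    ((Finsupp.single (∅, ∅) (∏ c ∈ C, X c) - if C ∈ K then Finsupp.single (∅, C) 1 else 0 :
      PairModule k V)) ∈
      (degreeModule k K 1).map (pairDifferential k K) := by
  induction C using Finset.induction_on with
  | empty => simp [h0]
  | insert a C ha ih =>
    have ih := Submodule.smul_mem _ (X a : MvPolynomial V k) ih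
    rw [smul_sub, Finsupp.smul_single, smul_eq_mul, ← Finset.prod_insert ha] at ih
    by_cases hC : C ∈ K
    · rw [if_pos hC] at ih
      have h1 : pairDifferential k K (Finsupp.single ({a}, C) 1) ∈
          (degreeModule k K 1).map (pairDifferential k K) :=
        Submodule.mem_map_of_mem (Finsupp.single_mem_supported _ _
          ⟨by simp, by simpa using ha, hC⟩)
      have h2 : pairDifferential k K (Finsupp.single ({a}, C) 1) =
          ((X a : MvPolynomial V k) • Finsupp.single (∅, C) 1 -
            if insert a C ∈ K then Finsupp.single (∅, insert a C) 1 else 0 : PairModule k V) := by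
        rw [pairDifferential, LinearMap.sum_apply, Finset.sum_eq_single a]
        · rw [vertexDifferential_single, if_pos (Finset.mem_singleton_self a)]
          simp [positionSign, Finset.filter_singleton]
        · intro b _ hb
          rw [vertexDifferential_single, if_neg (by simpa using hb)]
        · simp
      rw [h2] at h1
      have := Submodule.add_mem _ ih h1
      rwa [sub_add_sub_cancel] at this
    · rw [if_neg hC, smul_zero, sub_zero] at ih
      rwa [if_neg fun h => hC (hK _ h _ (Finset.subset_insert a C)), sub_zero]

theorem mem_map_pairDifferential (h0 : ∅ ∈ K) (hK : ∀ F ∈ K, ∀ G ⊆ F, G ∈ K) {z : PairModule k V}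
    (hz : z ∈ degreeModule k K 0) (h : pairAugmentation V k z ∈ srIdeal k K) :
    z ∈ (degreeModule k K 1).map (pairDifferential k K) := by
  classical
  have hI : srIdeal k K ≤ ((degreeModule k K 1).map (pairDifferential k K)).comap
      (Finsupp.lsingle (∅, ∅)) := by
    refine Submodule.span_le.2 ?_
    rintro _ ⟨C, hC, rfl⟩
    have := single_prod_sub_mem_map_pairDifferential (k := k) h0 hK C
    rwa [if_neg hC, sub_zero] at this
  have h1 : Finsupp.single (∅, ∅) (pairAugmentation V k z) ∈
      (degreeModule k K 1).map (pairDifferential k K) := hI h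
  have h2 : Finsupp.single (∅, ∅) (pairAugmentation V k z) - z ∈
      (degreeModule k K 1).map (pairDifferential k K) := by
    conv => enter [2]; rw [← Finsupp.sum_single z]
    rw [Finsupp.sum, map_sum, Finsupp.single_finsetSum, ← Finset.sum_sub_distrib]
    refine Submodule.sum_mem _ fun p hp => ?_
    obtain ⟨hc, -, hB⟩ := mem_degreeModule_iff.1 hz p.1 p.2 (Finsupp.mem_support_iff.1 hp)
    have := single_prod_sub_mem_map_pairDifferential (k := k) h0 hK p.2
    rw [if_pos hB] at this
    have := Submodule.smul_mem _ (z p) this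
    rw [smul_sub, Finsupp.smul_single, Finsupp.smul_single, smul_eq_mul, smul_eq_mul,
      mul_one] at this
    have hp1 : p = (∅, p.2) := Prod.ext (Finset.card_eq_zero.1 hc) rfl
    rw [← pairAugmentation_single (k := k) ∅ p.2, ← hp1] at this
    exact this
  have h3 := Submodule.sub_mem _ h1 h2
  rwa [sub_sub_cancel] at h3

variable (k) in
/-- The chain complex of the free modules on pairs `(A, B)`. -/
noncomputable def pairComplex (hK : ∀ F ∈ K, ∀ G ⊆ F, G ∈ K) :
    ChainComplex (ModuleCat (MvPolynomial V k)) ℕ :=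
  ChainComplex.of (fun i => ModuleCat.of _ (degreeModule k K i))
    (fun i => ModuleCat.ofHom ((pairDifferential k K).restrict
      (p := degreeModule k K (i + 1)) fun _ hz => pairDifferential_mem hz))
    (fun i => by
      refine ModuleCat.hom_ext (LinearMap.ext fun z => Subtype.ext ?_)
      exact pairDifferential_comp_self hK z.1)

variable (k K) in
/-- The augmentation of `pairComplex` onto the Stanley–Reisner ring. -/
noncomputable def pairComplexAugmentation :
    ModuleCat.of _ (degreeModule k K 0) ⟶ srRing k K :=
  ModuleCat.ofHom ((Submodule.mkQ (srIdeal k K)) ∘ₗ pairAugmentation V k ∘ₗ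
    (degreeModule k K 0).subtype)

theorem pairComplex_d (hK : ∀ F ∈ K, ∀ G ⊆ F, G ∈ K) (i : ℕ) :
    (pairComplex k hK).d (i + 1) i = ModuleCat.ofHom ((pairDifferential k K).restrict
      (p := degreeModule k K (i + 1)) (q := degreeModule k K i)
      fun _ hz => pairDifferential_mem hz) := by
  dsimp only [pairComplex]
  rw [ChainComplex.of_d]

theorem pairComplex_d_comp_augmentation (hK : ∀ F ∈ K, ∀ G ⊆ F, G ∈ K) :
    (pairComplex k hK).d 1 0 ≫ pairComplexAugmentation k K = 0 := by
  rw [pairComplex_d]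
  refine ModuleCat.hom_ext (LinearMap.ext fun z => ?_)
  exact (Submodule.Quotient.mk_eq_zero _).2 (pairAugmentation_pairDifferential_mem z.2)

variable (k) in
/-- The resolution of the Stanley–Reisner ring by the free modules on pairs `(A, B)`. -/
noncomputable def pairResolution (h0 : ∅ ∈ K) (hK : ∀ F ∈ K, ∀ G ⊆ F, G ∈ K) :
    ProjectiveResolution (srRing k K) where
  complex := pairComplex k hK
  projective i := by
    have : Module.Free (MvPolynomial V k) (degreeModule k K i) :=
      Module.Free.of_equiv (Finsupp.supportedEquivFinsupp (R := MvPolynomial V k)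
        (M := MvPolynomial V k) (degreePairs K i)).symm
    exact (IsProjective.iff_projective
      (ModuleCat.of (MvPolynomial V k) (degreeModule k K i))).1 inferInstance
  π := (ChainComplex.toSingle₀Equiv _ _).symm ⟨pairComplexAugmentation k K,
    pairComplex_d_comp_augmentation hK⟩
  quasiIso := ⟨fun n => by
    cases n with
    | zero =>
      rw [ChainComplex.quasiIsoAt₀_iff, ShortComplex.quasiIso_iff_of_zeros']
      · refine (ShortComplex.exact_and_epi_g_iff_of_iso
          (S₁ := ShortComplex.mk ((pairComplex k hK).d 1 0) (pairComplexAugmentation k K)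
            (pairComplex_d_comp_augmentation hK)) ?_).1 ⟨?_, ?_⟩
        · refine ShortComplex.isoMk (Iso.refl _) (Iso.refl _) (Iso.refl _) ?_ ?_
          · exact (Category.id_comp _).trans (Category.comp_id _).symm
          · refine (Category.id_comp _).trans (Eq.trans ?_ (Category.comp_id _).symm)
            exact ChainComplex.toSingle₀Equiv_symm_apply_f_zero _ _
        · rw [ShortComplex.moduleCat_exact_iff]
          intro z hz
          obtain ⟨y, hy, hyz⟩ := mem_map_pairDifferential h0 hK z.2
            ((Submodule.Quotient.mk_eq_zero _).1 hz)
          refine ⟨⟨y, hy⟩, ?_⟩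
          change (pairComplex k hK).d 1 0 _ = _
          rw [pairComplex_d]
          exact Subtype.ext hyz
        · rw [ModuleCat.epi_iff_surjective]
          intro x
          obtain ⟨g, rfl⟩ := Submodule.Quotient.mk_surjective _ x
          refine ⟨⟨Finsupp.single (∅, ∅) g, Finsupp.single_mem_supported _ _
            ⟨by simp, by simp, h0⟩⟩, ?_⟩
          refine congrArg (Submodule.Quotient.mk (p := srIdeal k K)) ?_
          exact (pairAugmentation_single ∅ ∅ g).trans (by simp)
      all_goals rfl
    | succ n =>
      rw [quasiIsoAt_iff_exactAt']
      · rw [HomologicalComplex.exactAt_iff' _ (n + 2) (n + 1) n (by simp) (by simp),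
          ShortComplex.moduleCat_exact_iff]
        intro z hz
        have hz : (pairComplex k hK).d (n + 1) n z = 0 := hz
        rw [pairComplex_d] at hz
        obtain ⟨y, hy, hyz⟩ := exists_pairDifferential_eq hK z.2 (congrArg Subtype.val hz)
        refine ⟨⟨y, hy⟩, ?_⟩
        change (pairComplex k hK).d (n + 2) (n + 1) _ = _
        rw [pairComplex_d]
        exact Subtype.ext hyz
      · apply ChainComplex.exactAt_succ_single_obj⟩

theorem exists_comp_of_mem_annihilator {R : Type} [CommRing R] {M N : ModuleCat R}
    (P : ProjectiveResolution M) {i : ℕ} {f : R} (hf : f ∈ Module.annihilator R (extM M N i))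
    (φ : P.complex.X i ⟶ N) (hφ : P.complex.d (i + 1) i ≫ φ = 0) :
    ∃ (j : ℕ) (ψ : P.complex.X j ⟶ N), f • φ = P.complex.d i j ≫ ψ := by
  let C := P.complex.linearYonedaObj R N
  let T := C.sc i
  let e : extM M N i ≅ ModuleCat.of R
      (LinearMap.ker T.g.hom ⧸ LinearMap.range T.moduleCatToCycles) :=
    P.isoExt i N ≪≫ T.moduleCatHomologyIso
  have hφ' : T.g φ = 0 := by
    change P.complex.d _ i ≫ φ = 0
    rw [CochainComplex.next]
    exact hφ
  let c : LinearMap.ker T.g.hom := ⟨φ, hφ'⟩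
  let q : ModuleCat.of R (LinearMap.ker T.g.hom ⧸ LinearMap.range T.moduleCatToCycles) :=
    Submodule.Quotient.mk c
  have h1 : f • q = 0 := by
    have := Module.mem_annihilator.1 hf (e.inv q)
    have h2 := congrArg e.hom this
    simpa using h2
  obtain ⟨ψ, hψ⟩ := (Submodule.Quotient.mk_eq_zero _ (x := f • c)).1 h1
  exact ⟨_, ψ, (congrArg Subtype.val hψ).symm⟩

/-- A cocycle on the resolution by pairs becomes a coboundary after multiplication with an element
annihilating the corresponding `Ext` module. -/
theorem exists_mul_eq_of_mem_annihilator (h0 : ∅ ∈ K) (hK : ∀ F ∈ K, ∀ G ⊆ F, G ∈ K) {i : ℕ}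
    {f : MvPolynomial V k}
    (hf : f ∈ Module.annihilator (MvPolynomial V k)
      (extM (srRing k K) (ModuleCat.of _ (MvPolynomial V k)) i))
    (φ : PairModule k V →ₗ[MvPolynomial V k] MvPolynomial V k)
    (hφ : ∀ z ∈ degreeModule k K (i + 1), φ (pairDifferential k K z) = 0) :
    ∃ ψ : PairModule k V →ₗ[MvPolynomial V k] MvPolynomial V k,
      ∀ z ∈ degreeModule k K i, f * φ z = ψ (pairDifferential k K z) := by
  classical
  let Φ : (pairComplex k hK).X i ⟶ ModuleCat.of _ (MvPolynomial V k) :=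
    ModuleCat.ofHom (φ ∘ₗ (degreeModule k K i).subtype)
  have hΦ : (pairComplex k hK).d (i + 1) i ≫ Φ = 0 := by
    rw [pairComplex_d]
    exact ModuleCat.hom_ext (LinearMap.ext fun z => hφ z.1 z.2)
  obtain ⟨j, ψ, h⟩ : ∃ (j : ℕ) (ψ : (pairComplex k hK).X j ⟶ ModuleCat.of _ (MvPolynomial V k)),
      f • Φ = (pairComplex k hK).d i j ≫ ψ :=
    exists_comp_of_mem_annihilator (pairResolution k h0 hK) hf Φ hΦ
  by_cases hij : j + 1 = i
  · subst hij
    rw [pairComplex_d] at h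
    let ψ' : degreeModule k K j →ₗ[MvPolynomial V k] MvPolynomial V k := ψ.hom
    refine ⟨ψ' ∘ₗ Finsupp.restrictDom _ _ (degreePairs K j), fun z hz => ?_⟩
    have h1 := congrArg (fun g => ModuleCat.Hom.hom g (⟨z, hz⟩ : degreeModule k K (j + 1))) h
    refine Eq.trans h1 (congrArg ψ' (Subtype.ext ?_))
    refine Eq.symm ?_
    simp only [Finsupp.restrictDom_apply]
    exact (Finsupp.filter_eq_self_iff _ _).2 fun p hp =>
      (Finsupp.mem_supported _ _).1 (pairDifferential_mem hz) (Finsupp.mem_support_iff.2 hp)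
  · rw [(pairComplex k hK).shape i j hij, Limits.zero_comp] at h
    refine ⟨0, fun z hz => ?_⟩
    rw [LinearMap.zero_apply]
    have h1 := congrArg (fun g => g (⟨z, hz⟩ : degreeModule k K i)) (ModuleCat.hom_ext_iff.1 h)
    rw [ModuleCat.hom_zero] at h1
    exact h1

theorem pairDifferential_single (A B : Finset V) (g : MvPolynomial V k) [Decidable (B ∈ K)]
    [∀ a, Decidable (insert a B ∈ K)] :
    pairDifferential k K (Finsupp.single (A, B) g) =
      ∑ a ∈ A, (Finsupp.single (A.erase a, B) (positionSign _ A a * X a * g) -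
          if insert a B ∈ K then
            Finsupp.single (A.erase a, insert a B) (positionSign _ A a * g) else 0) := by
  simp only [pairDifferential, LinearMap.sum_apply, vertexDifferential_single]
  rw [Finset.sum_ite_mem, Finset.univ_inter]
  refine Finset.sum_congr rfl fun a _ => ?_
  congr

omit [Fintype V] in
theorem map_positionSign {R S : Type} [CommRing R] [CommRing S] (f : R →+* S) (A : Finset V)
    (a : V) : f (positionSign R A a) = positionSign S A a := by
  simp [positionSign]

omit [Fintype V] in
theorem positionSign_union (R : Type) [CommRing R] {A B : Finset V} (h : Disjoint A B) (a : V) :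
    positionSign R (A ∪ B) a = positionSign R A a * positionSign R B a := by
  rw [positionSign, Finset.filter_union, Finset.card_union_of_disjoint
    (Finset.disjoint_filter_filter h), pow_add, positionSign, positionSign]

/-- The product of the position signs in the complement of `F` of the elements of `B`. -/
def twistSign (R : Type) [CommRing R] (F B : Finset V) : R :=
  ∏ b ∈ B, positionSign R Fᶜ b

theorem twistSign_mul_self (R : Type) [CommRing R] (F B : Finset V) :
    twistSign R F B * twistSign R F B = 1 := by
  rw [twistSign, ← Finset.prod_mul_distrib]
  exact Finset.prod_eq_one fun b _ => positionSign_mul_self R _ b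

theorem positionSign_mul_twistSign_insert (R : Type) [CommRing R] {F B : Finset V}
    (hBF : Disjoint B F) {a : V} (ha : a ∉ B) :
    positionSign R (B ∪ F)ᶜ a * twistSign R F (insert a B) =
      twistSign R F B * positionSign R B a := by
  have h : Fᶜ = (B ∪ F)ᶜ ∪ B := by
    ext x
    have := fun hx : x ∈ B => Finset.disjoint_left.1 hBF hx
    simp only [Finset.mem_compl, Finset.mem_union]
    tauto
  have hd : Disjoint (B ∪ F)ᶜ B :=
    disjoint_compl_left.mono_right Finset.subset_union_left
  rw [twistSign, Finset.prod_insert ha, ← twistSign, congrArg (positionSign R · a) h,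
    positionSign_union R hd]
  linear_combination twistSign R F B * positionSign R B a *
    positionSign_mul_self R (B ∪ F)ᶜ a

/-! ### Homology of links and annihilators of `Ext` -/

variable (K) in
/-- The chains on the faces with `j` vertices of `link K F`, as functions on all finite sets. -/
def IsFaceChain (j : ℕ) (c : Finset V → k) : Prop :=
  ∀ B, c B ≠ 0 → B ∈ K ∧ B.card = j

/-- The simplicial boundary of a chain on all finite subsets of `V`. -/
def chainBoundary (c : Finset V → k) (B : Finset V) : k :=
  ∑ a ∈ Bᶜ, positionSign k B a * c (insert a B)

/-- The linear form on the pairs `(A, B)` given by a chain `c` on the link of `F`. -/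
noncomputable def linkForm (F : Finset V) (c : Finset V → k) :
    PairModule k V →ₗ[MvPolynomial V k] MvPolynomial V k :=
  Finsupp.lsum (MvPolynomial V k) fun p => LinearMap.toSpanSingleton _ _
    (if p.1 = (p.2 ∪ F)ᶜ then
      C (twistSign k F (p.2 \ F) * c (p.2 \ F)) * ∏ b ∈ p.2 ∩ F, X b else 0)

theorem linkForm_single (F : Finset V) (c : Finset V → k) (A B : Finset V)
    (g : MvPolynomial V k) :
    linkForm F c (Finsupp.single (A, B) g) = g *
      if A = (B ∪ F)ᶜ then C (twistSign k F (B \ F) * c (B \ F)) * ∏ b ∈ B ∩ F, X b else 0 := by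
  simp [linkForm]

theorem linkForm_pairDifferential {F : Finset V} {j : ℕ} {c : Finset V → k}
    (hK : ∀ F ∈ K, ∀ G ⊆ F, G ∈ K)
    (hc : IsFaceChain (link K F) j c) (hcyc : chainBoundary c = 0) {i : ℕ} {z : PairModule k V}
    (hz : z ∈ degreeModule k K i) : linkForm F c (pairDifferential k K z) = 0 := by
  classical
  rw [← Finsupp.sum_single z, Finsupp.sum]
  simp only [map_sum]
  refine Finset.sum_eq_zero fun p hp => ?_
  obtain ⟨-, hd, -⟩ := mem_degreeModule_iff.1 hz p.1 p.2 (Finsupp.mem_support_iff.1 hp)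
  generalize z p = g
  obtain ⟨A, B⟩ := p
  dsimp only at hd
  rw [pairDifferential_single, map_sum]
  have hterm : ∀ a ∈ A, linkForm F c (Finsupp.single (A.erase a, B) (positionSign _ A a * X a * g) -
      if insert a B ∈ K then
        Finsupp.single (A.erase a, insert a B) (positionSign _ A a * g) else 0) =
      - (if A = (B ∪ F)ᶜ then g * C (twistSign k F (B \ F)) * (∏ b ∈ B ∩ F, X b) *
        C (positionSign k (B \ F) a * c (insert a (B \ F))) else 0) := by
    intro a ha
    have haB : a ∉ B := Finset.disjoint_left.1 hd ha
    have hface : c ((insert a B) \ F) ≠ 0 → insert a B ∈ K := fun h =>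
      hK _ (hc _ h).1.1 _ fun x hx => by
        by_cases hxF : x ∈ F
        · exact Finset.mem_union_right _ hxF
        · exact Finset.mem_union_left _ (Finset.mem_sdiff.2 ⟨hx, hxF⟩)
    have h2 : linkForm F c (if insert a B ∈ K then
        Finsupp.single (A.erase a, insert a B) (positionSign _ A a * g) else 0) =
        linkForm F c (Finsupp.single (A.erase a, insert a B) (positionSign _ A a * g)) := by
      split_ifs with h
      · rfl
      · rw [map_zero, linkForm_single, not_imp_comm.1 hface h]
        simp
    rw [map_sub, h2, linkForm_single, linkForm_single]
    by_cases haF : a ∈ F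
    · have e1 : insert a B ∪ F = B ∪ F := by
        rw [Finset.insert_union, Finset.insert_eq_self]; exact Finset.mem_union_right _ haF
      have e2 : insert a B \ F = B \ F := Finset.insert_sdiff_of_mem _ haF
      have e3 : insert a B ∩ F = insert a (B ∩ F) := Finset.insert_inter_of_mem haF
      have hA : A ≠ (B ∪ F)ᶜ := by
        rintro rfl
        exact Finset.mem_compl.1 ha (Finset.mem_union_right _ haF)
      rw [e1, e2, e3, Finset.prod_insert (by simp [haB]), if_neg hA]
      split_ifs <;> ring
    · have e2 : insert a B \ F = insert a (B \ F) := Finset.insert_sdiff_of_notMem _ haF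
      have e3 : insert a B ∩ F = B ∩ F := Finset.insert_inter_of_notMem haF
      have hA : A.erase a ≠ (B ∪ F)ᶜ := by
        intro h
        have : a ∈ (B ∪ F)ᶜ := by simp [haB, haF]
        exact Finset.notMem_erase a A (h ▸ this)
      have e4 : A.erase a = (insert a B ∪ F)ᶜ ↔ A = (B ∪ F)ᶜ := by
        constructor
        · intro h
          rw [← Finset.insert_erase ha, h]
          ext x
          by_cases hx : x = a <;> simp [hx, haB, haF]
        · rintro rfl
          ext x
          by_cases hx : x = a <;> simp [hx, haB, haF]
      rw [if_neg hA, e2, e3]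
      simp only [e4]
      split_ifs with h
      · have hs := positionSign_mul_twistSign_insert k (F := F) (B := B \ F) (a := a)
          Finset.sdiff_disjoint (by simp [haB])
        rw [Finset.sdiff_union_self_eq_union, ← h] at hs
        have hs := congrArg (C (σ := V)) hs
        rw [C_mul, C_mul, map_positionSign C A] at hs
        rw [C_mul, C_mul]
        linear_combination (-g * C (c (insert a (B \ F))) * (∏ b ∈ B ∩ F, X b)) * hs
      · ring
  rw [Finset.sum_congr rfl hterm, Finset.sum_neg_distrib, neg_eq_zero]
  by_cases hA : A = (B ∪ F)ᶜ
  · simp only [if_pos hA]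
    rw [← Finset.mul_sum, ← map_sum]
    have h0 : chainBoundary c (B \ F) = 0 := congrFun hcyc _
    have : ∑ a ∈ A, positionSign k (B \ F) a * c (insert a (B \ F)) = 0 := by
      rw [← h0, chainBoundary, hA]
      refine Finset.sum_subset (Finset.compl_subset_compl.2 (Finset.sdiff_subset.trans
        Finset.subset_union_left)) fun a ha ha' => ?_
      have haF : a ∈ F := by
        simp only [Finset.mem_compl, Finset.mem_sdiff, Finset.mem_union] at ha ha'
        tauto
      by_contra hne
      have := (hc _ (right_ne_zero_of_mul hne)).1.2
      have h1 : a ∈ insert a (B \ F) ∩ F := by simp [haF]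
      rw [this] at h1
      simp at h1
    rw [this]; simp
  · simp only [if_neg hA, Finset.sum_const_zero]

variable (k) in
/-- The quotient map of `k[x_v : v ∈ V]` by the variables outside `F`. -/
noncomputable def killCompl (F : Finset V) : MvPolynomial V k →ₐ[k] MvPolynomial F k :=
  aeval fun v => if h : v ∈ F then X ⟨v, h⟩ else 0

omit [Fintype V] in
theorem killCompl_surjective (F : Finset V) : Function.Surjective (killCompl k F) := by
  intro g
  refine ⟨rename Subtype.val g, ?_⟩
  rw [killCompl, aeval_rename]
  convert aeval_X_left_apply g
  ext v : 1
  simp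

theorem killCompl_eq_zero {F : Finset V} {j : ℕ} {c : Finset V → k} (h0 : ∅ ∈ K)
    (hK : ∀ F ∈ K, ∀ G ⊆ F, G ∈ K)
    (hc : IsFaceChain (link K F) j c) (hcyc : chainBoundary c = 0)
    (hnb : ∀ b, IsFaceChain (link K F) (j + 1) b → chainBoundary b ≠ c) {i : ℕ}
    (hi : i + j + F.card = Fintype.card V) {f : MvPolynomial V k}
    (hf : f ∈ Module.annihilator (MvPolynomial V k)
      (extM (srRing k K) (ModuleCat.of _ (MvPolynomial V k)) i)) :
    killCompl k F f = 0 := by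
  classical
  obtain ⟨ψ, hψ⟩ := exists_mul_eq_of_mem_annihilator h0 hK hf (linkForm F c)
    fun z hz => linkForm_pairDifferential hK hc hcyc hz
  by_contra hne
  have hXF : killCompl k F (∏ b ∈ F, X b) ≠ 0 := by
    rw [map_prod, Finset.prod_ne_zero_iff]
    intro b hb
    simp [killCompl, hb]
  obtain ⟨m, hm⟩ := MvPolynomial.ne_zero_iff.1 (mul_ne_zero hne hXF)
  set μ := coeff m (killCompl k F f * killCompl k F (∏ b ∈ F, X b)) with hμ
  let h : Finset V → k := fun D =>
    coeff m (killCompl k F (ψ (Finsupp.single ((D ∪ F)ᶜ, D ∪ F) 1)))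
  let b : Finset V → k := fun D =>
    if D ∈ link K F ∧ D.card = j + 1 then -μ⁻¹ * (twistSign k F D * h D) else 0
  refine hnb b (fun D hD => ?_) ?_
  · by_contra hD'
    exact hD (if_neg hD')
  funext B
  by_cases hB : B ∈ link K F ∧ B.card = j
  swap
  · rw [not_ne_iff.1 (mt (hc B) hB), chainBoundary]
    refine Finset.sum_eq_zero fun a ha => ?_
    have haB := Finset.mem_compl.1 ha
    have : b (insert a B) = 0 := by
      refine if_neg fun ⟨h1, h2⟩ => hB ⟨⟨hK _ h1.1 _ ?_, ?_⟩, ?_⟩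
      · exact Finset.union_subset_union_left (Finset.subset_insert _ _)
      · exact Finset.subset_empty.1
          ((Finset.inter_subset_inter_right (Finset.subset_insert a B)).trans_eq h1.2)
      · rw [Finset.card_insert_of_notMem haB] at h2; omega
    rw [this, mul_zero]
  obtain ⟨⟨hBK, hBF⟩, hBj⟩ := hB
  have hBF' : Disjoint B F := Finset.disjoint_iff_inter_eq_empty.2 hBF
  have hmem : (Finsupp.single ((B ∪ F)ᶜ, B ∪ F) 1 : PairModule k V) ∈ degreeModule k K i := by
    refine Finsupp.single_mem_supported _ _ ⟨?_, disjoint_compl_left, hBK⟩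
    rw [Finset.card_compl, Finset.card_union_of_disjoint hBF', hBj]
    omega
  have key := congrArg (fun p => coeff m (killCompl k F p)) (hψ _ hmem)
  have e1 : (B ∪ F) \ F = B := by
    rw [Finset.union_sdiff_right, Finset.sdiff_eq_self_of_disjoint hBF']
  have e2 : (B ∪ F) ∩ F = F := Finset.inter_eq_right.2 Finset.subset_union_right
  rw [linkForm_single, if_pos (by rw [Finset.union_assoc, Finset.union_self]), e1, e2,
    pairDifferential_single, map_sum, map_sum] at key
  have hl : coeff m (killCompl k F (f * (1 * (C (twistSign k F B * c B) * ∏ b ∈ F, X b)))) =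
      μ * (twistSign k F B * c B) := by
    rw [hμ, mul_comm (coeff m _), ← coeff_C_mul, map_mul, one_mul, map_mul]
    congr 1
    rw [killCompl, aeval_C]
    simp only [algebraMap_eq]
    ring
  rw [hl, coeff_sum] at key
  have hterm : ∀ a ∈ (B ∪ F)ᶜ, coeff m (killCompl k F (ψ
      (Finsupp.single ((B ∪ F)ᶜ.erase a, B ∪ F) (positionSign _ (B ∪ F)ᶜ a * X a * 1) -
        if insert a (B ∪ F) ∈ K then
          Finsupp.single ((B ∪ F)ᶜ.erase a, insert a (B ∪ F)) (positionSign _ (B ∪ F)ᶜ a * 1)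
        else 0))) = μ * twistSign k F B * (positionSign k B a * b (insert a B)) := by
    intro a ha
    have haB : a ∉ B := fun h => Finset.mem_compl.1 ha (Finset.mem_union_left _ h)
    have haF : a ∉ F := fun h => Finset.mem_compl.1 ha (Finset.mem_union_right _ h)
    have h1 : ∀ (p : Finset V × Finset V) (g : MvPolynomial V k),
        ψ (Finsupp.single p g) = g * ψ (Finsupp.single p 1) := by
      intro p g
      rw [← smul_eq_mul, ← map_smul, Finsupp.smul_single_one]
    have hX : killCompl k F (X a) = 0 := by simp [killCompl, haF]
    have hlink : insert a (B ∪ F) ∈ K ↔ insert a B ∈ link K F ∧ (insert a B).card = j + 1 := by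
      rw [Finset.card_insert_of_notMem haB, hBj, link, Set.mem_ofPred_eq, Finset.insert_union,
        Finset.insert_inter_of_notMem haF, hBF]
      simp
    have e3 : (B ∪ F)ᶜ.erase a = (insert a B ∪ F)ᶜ := by
      rw [Finset.insert_union, Finset.compl_insert]
    have hs := positionSign_mul_twistSign_insert k hBF' haB
    have hsgn : killCompl k F (positionSign _ (B ∪ F)ᶜ a) = C (positionSign k (B ∪ F)ᶜ a) := by
      rw [map_positionSign C]
      exact map_positionSign (killCompl k F).toRingHom _ _
    rw [map_sub, map_sub, h1, map_mul, map_mul, map_mul, hX, mul_zero, zero_mul, zero_mul, zero_sub,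
      coeff_neg]
    by_cases hl : insert a (B ∪ F) ∈ K
    · have hb : b (insert a B) = -μ⁻¹ * (twistSign k F (insert a B) * h (insert a B)) :=
        if_pos (hlink.1 hl)
      rw [if_pos hl, h1, map_mul, mul_one, hsgn, coeff_C_mul, e3, ← Finset.insert_union, hb]
      change -(_ * h (insert a B)) = _
      have hs2 := twistSign_mul_self k F (insert a B)
      have hμ' : μ * μ⁻¹ = 1 := mul_inv_cancel₀ hm
      linear_combination twistSign k F B * positionSign k B a *
        twistSign k F (insert a B) * h (insert a B) * hμ' - h (insert a B) *
        twistSign k F (insert a B) * hs + positionSign k (B ∪ F)ᶜ a * h (insert a B) * hs2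
    · have hb : b (insert a B) = 0 := if_neg (mt hlink.2 hl)
      rw [if_neg hl, hb]
      simp
  rw [Finset.sum_congr rfl hterm, ← Finset.mul_sum, ← mul_assoc] at key
  have hne' : μ * twistSign k F B ≠ 0 :=
    mul_ne_zero hm (left_ne_zero_of_mul (b := twistSign k F B) (by rw [twistSign_mul_self]; simp))
  refine Eq.trans ?_ (mul_left_cancel₀ hne' key).symm
  refine (Finset.sum_subset (Finset.compl_subset_compl.2 Finset.subset_union_left)
    fun a ha ha' => ?_).symm
  have haF : a ∈ F := by
    simp only [Finset.mem_compl, Finset.mem_union] at ha ha'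
    tauto
  have : b (insert a B) = 0 := if_neg fun ⟨h1, _⟩ => by
    have h2 : a ∈ insert a B ∩ F := by simp [haF]
    rw [h1.2] at h2
    simp at h2
  rw [this, mul_zero]

/-! ### Homology of deletions and links -/

variable (k K) in
/-- Every cycle on the faces with `j` vertices is a boundary. -/
def IsAcyclicAt (j : ℕ) : Prop :=
  ∀ c : Finset V → k, IsFaceChain K j c → chainBoundary c = 0 →
    ∃ b, IsFaceChain K (j + 1) b ∧ chainBoundary b = c

theorem chainBoundary_add (b c : Finset V → k) :
    chainBoundary (b + c) = chainBoundary b + chainBoundary c := by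
  funext B
  simp [chainBoundary, mul_add, Finset.sum_add_distrib]

omit [Fintype V] in
theorem positionSign_insert_mul_positionSign (R : Type) [CommRing R] {B : Finset V} {a v : V}
    (ha : a ∉ B) (hv : v ∉ B) (hav : a ≠ v) :
    positionSign R B a * positionSign R (insert a B) v =
      -(positionSign R B v * positionSign R (insert v B) a) := by
  have h := positionSign_insert_mul R (A := insert a B) (Finset.mem_insert_self a B)
    (s := v) (by simp [hv, hav.symm])
  rw [Finset.erase_insert ha, ← positionSign_erase_self R (insert v (insert a B)) a,
    ← positionSign_erase_self R (insert a B) a, Finset.erase_insert ha, Finset.insert_comm,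
    Finset.erase_insert (by simp [ha, hav])] at h
  linear_combination positionSign R B a * positionSign R (insert v B) a * h -
    positionSign R B a * positionSign R (insert a B) v * positionSign_mul_self R (insert v B) a -
    positionSign R B v * positionSign R (insert v B) a * positionSign_mul_self R B a

theorem IsAcyclicAt.deletion (hK : ∀ F ∈ K, ∀ G ⊆ F, G ∈ K) {v : V} {j : ℕ}
    (h : IsAcyclicAt k K j) (hv : IsAcyclicAt k (link K {v}) j) :
    IsAcyclicAt k {F ∈ K | v ∉ F} j := by
  classical
  intro c hc hcyc
  obtain ⟨b, hb, rfl⟩ := h c (fun B hB => ⟨(hc B hB).1.1, (hc B hB).2⟩) hcyc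
  let b₀ : Finset V → k := fun B => if v ∈ B then 0 else b B
  let b₁ : Finset V → k := fun B => if v ∈ B then 0 else positionSign k B v * b (insert v B)
  have hb₁ : IsFaceChain (link K {v}) j b₁ := by
    intro B hB
    have hvB : v ∉ B := fun hvB => hB (if_pos hvB)
    have hB' : b₁ B = positionSign k B v * b (insert v B) := if_neg hvB
    obtain ⟨h1, h2⟩ := hb _ (right_ne_zero_of_mul (hB' ▸ hB))
    rw [Finset.card_insert_of_notMem hvB] at h2
    refine ⟨⟨?_, Finset.inter_singleton_of_notMem hvB⟩, by omega⟩
    rwa [Finset.union_comm, ← Finset.insert_eq]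
  have hsum : ∀ B, v ∉ B → chainBoundary b B = chainBoundary b₀ B + b₁ B := by
    intro B hvB
    have hmem : v ∈ Bᶜ := Finset.mem_compl.2 hvB
    rw [chainBoundary, chainBoundary, ← Finset.sum_erase_add _ _ hmem,
      ← Finset.sum_erase_add _ _ hmem]
    simp only [b₀, b₁, Finset.mem_insert_self, if_true, hvB, if_false, mul_zero, add_zero]
    congr 1
    refine Finset.sum_congr rfl fun a ha => ?_
    have : v ∉ insert a B := by simp [hvB, (Finset.ne_of_mem_erase ha).symm]
    rw [if_neg this]
  have hcyc₁ : chainBoundary b₁ = 0 := by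
    funext B
    by_cases hvB : v ∈ B
    · exact Finset.sum_eq_zero fun a _ => by simp [b₁, hvB]
    have h0 : chainBoundary b (insert v B) = 0 := by
      by_contra hne
      exact (hc _ hne).1.2 (Finset.mem_insert_self v B)
    have hmem : v ∈ Bᶜ := Finset.mem_compl.2 hvB
    rw [chainBoundary, Finset.compl_insert] at h0
    rw [chainBoundary, ← Finset.sum_erase_add _ _ hmem]
    have : ∀ a ∈ Bᶜ.erase v, positionSign k B a * b₁ (insert a B) = -positionSign k B v *
        (positionSign k (insert v B) a * b (insert a (insert v B))) := by
      intro a ha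
      have hav := Finset.ne_of_mem_erase ha
      have haB := Finset.mem_compl.1 (Finset.mem_of_mem_erase ha)
      have h1 : v ∉ insert a B := by simp [hvB, hav.symm]
      simp only [b₁, if_neg h1]
      rw [Finset.insert_comm v a]
      linear_combination b (insert a (insert v B)) *
        positionSign_insert_mul_positionSign k haB hvB hav
    rw [Finset.sum_congr rfl this, ← Finset.mul_sum, h0]
    simp [b₁]
  obtain ⟨e, he, hbe⟩ := hv b₁ hb₁ hcyc₁
  refine ⟨b₀ + e, fun B hB => ?_, ?_⟩
  · rcases ne_or_eq (e B) 0 with heB | heB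
    · obtain ⟨⟨h1, h2⟩, h3⟩ := he B heB
      exact ⟨⟨hK _ h1 _ Finset.subset_union_left,
        fun hvB => by simp [Finset.inter_singleton_of_mem hvB] at h2⟩, h3⟩
    · have hB' : b₀ B ≠ 0 := by simpa [heB] using hB
      have hvB : v ∉ B := fun hvB => hB' (if_pos hvB)
      have := hb B (by simpa [b₀, hvB] using hB')
      exact ⟨⟨this.1, hvB⟩, this.2⟩
  · funext B
    rw [chainBoundary_add, hbe, Pi.add_apply]
    by_cases hvB : v ∈ B
    · have h0 : chainBoundary b B = 0 := by
        by_contra hne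
        exact (hc _ hne).1.2 hvB
      rw [h0, chainBoundary, Finset.sum_eq_zero fun a _ => by simp [b₀, hvB]]
      simp [b₁, hvB]
    · exact (hsum B hvB).symm

omit [Fintype V] in
theorem link_mem_of_subset (hK : ∀ F ∈ K, ∀ G ⊆ F, G ∈ K) (F : Finset V) :
    ∀ G ∈ link K F, ∀ H ⊆ G, H ∈ link K F := fun _ hG _ hH =>
  ⟨hK _ hG.1 _ (Finset.union_subset_union_left hH),
    Finset.subset_empty.1 ((Finset.inter_subset_inter_right hH).trans_eq hG.2)⟩

theorem IsAcyclicAt.of_link (U : Finset V) {j : ℕ} (hK : ∀ F ∈ K, ∀ G ⊆ F, G ∈ K)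
    (h : ∀ F ⊆ U, IsAcyclicAt k (link K F) j) : IsAcyclicAt k {G ∈ K | Disjoint G U} j := by
  induction U using Finset.induction_on generalizing K with
  | empty =>
    convert h ∅ (Finset.Subset.refl _) using 1
    ext G
    simp [link]
  | insert v U hv ih =>
    have hL : ∀ F ∈ {G ∈ K | Disjoint G U}, ∀ G ⊆ F, G ∈ {G ∈ K | Disjoint G U} :=
      fun F hF G hG => ⟨hK F hF.1 G hG, hF.2.mono_left hG⟩
    have h1 := ih hK fun F hF => h F (hF.trans (Finset.subset_insert _ _))
    have h2 : IsAcyclicAt k (link {G ∈ K | Disjoint G U} {v}) j := by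
      convert ih (link_mem_of_subset hK {v}) fun F hF => ?_ using 1
      · ext G
        simp [link, hv, and_right_comm]
      · convert h (insert v F) (Finset.insert_subset_insert v hF) using 1
        have hvF : v ∉ F := fun h => hv (hF h)
        ext G
        simp only [link, Set.mem_ofPred_eq, ← Finset.disjoint_iff_inter_eq_empty,
          Finset.disjoint_insert_right, Finset.disjoint_singleton_right]
        rw [Finset.union_assoc, Finset.union_comm F, ← Finset.insert_eq]
        have : v ∉ G ∪ F ↔ v ∉ G := by simp [hvF]
        rw [this, and_assoc]
    convert h1.deletion hL h2 using 1
    ext G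
    simp only [Finset.disjoint_insert_right, Set.mem_ofPred_eq]
    tauto

/-- A simplicial chain as a function on all finite subsets of `V`. -/
noncomputable def chainFun {j : ℕ} (x : chainGroup k K j) : Finset V → k :=
  Finsupp.mapDomain Subtype.val x

omit [LinearOrder V] [Fintype V] in
theorem chainFun_injective {j : ℕ} :
    Function.Injective (chainFun : chainGroup k K j → Finset V → k) :=
  DFunLike.coe_injective.comp (Finsupp.mapDomain_injective Subtype.val_injective)

omit [LinearOrder V] [Fintype V] in
theorem isFaceChain_chainFun {j : ℕ} (x : chainGroup k K j) : IsFaceChain K j (chainFun x) := by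
  intro B hB
  by_contra h
  exact hB (Finsupp.mapDomain_of_notMem_range _ _ (by simpa using h))

omit [LinearOrder V] in
theorem exists_chainFun_eq {j : ℕ} {c : Finset V → k} (hc : IsFaceChain K j c) :
    ∃ x : chainGroup k K j, chainFun x = c := by
  classical
  refine ⟨(Finsupp.equivFunOnFinite.symm c).comapDomain Subtype.val
    Subtype.val_injective.injOn, ?_⟩
  rw [chainFun, Finsupp.mapDomain_comapDomain _ Subtype.val_injective]
  · rfl
  · intro B hB
    simpa using hc B (by simpa using hB)

theorem chainFun_boundary (hK : ∀ F ∈ K, ∀ G ⊆ F, G ∈ K) {j : ℕ} (x : chainGroup k K (j + 1)) :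
    chainFun (boundary k K j x) = chainBoundary (chainFun x) := by
  classical
  induction x using Finsupp.induction_linear with
  | zero =>
    funext B
    simp [chainFun, chainBoundary]
  | add x y hx hy =>
    have hadd : ∀ {i : ℕ} (x y : chainGroup k K i), chainFun (x + y) = chainFun x + chainFun y :=
      fun x y => by simp [chainFun, Finsupp.mapDomain_add]
    rw [map_add, hadd, hadd, chainBoundary_add, hx, hy]
  | single F r =>
    funext B
    rw [chainFun, boundary, Finsupp.lsum_single, LinearMap.toSpanSingleton_apply, boundaryAt,
      Finsupp.mapDomain_smul, ← Finsupp.mapDomain.addMonoidHom_apply, map_sum]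
    have : ∀ x ∈ F.1.attach, Finsupp.mapDomain.addMonoidHom Subtype.val
        (if h : F.1.erase x.1 ∈ K then
          (Finsupp.single ⟨F.1.erase x.1, h, by simp [Finset.card_erase_of_mem x.2, F.2.2]⟩
            ((-1 : k) ^ (F.1.filter (fun y => y < x.1)).card) : chainGroup k K j) else 0) =
        Finsupp.single (F.1.erase x.1) (positionSign k F.1 x.1) := by
      intro x _
      rw [dif_pos (hK _ F.2.1 _ (Finset.erase_subset _ _)), Finsupp.mapDomain.addMonoidHom_apply,
        Finsupp.mapDomain_single, positionSign]
    have hS : ∀ (S : Finset V) (g : V → k), ∑ x ∈ S, g x = ∑ x, if x ∈ S then g x else 0 :=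
      fun S g => by rw [Finset.sum_ite_mem, Finset.univ_inter]
    rw [Finset.sum_congr rfl this, Finset.sum_attach F.1 fun x =>
      Finsupp.single (F.1.erase x) (positionSign k F.1 x), Finsupp.smul_apply,
      Finsupp.finsetSum_apply, smul_eq_mul, Finset.mul_sum, chainBoundary, chainFun,
      Finsupp.mapDomain_single, hS F.1, hS Bᶜ]
    refine Finset.sum_congr rfl fun a _ => ?_
    by_cases h : a ∈ F.1 ∧ F.1.erase a = B
    · obtain ⟨h1, rfl⟩ := h
      simp [h1, Finset.insert_erase, positionSign_erase_self, mul_comm]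
    · have h' : ¬ (a ∉ B ∧ F.1 = insert a B) := by
        rintro ⟨h1, h2⟩
        exact h ⟨h2 ▸ Finset.mem_insert_self a B, by rw [h2, Finset.erase_insert h1]⟩
      simp only [Finset.mem_compl]
      have e1 : (if a ∈ F.1 then r * Finsupp.single (F.1.erase a) (positionSign k F.1 a) B else 0) =
          0 := by
        split_ifs with ha
        · rw [Finsupp.single_eq_of_ne (fun e => h ⟨ha, e.symm⟩), mul_zero]
        · rfl
      have e2 : (if a ∉ B then positionSign k B a * Finsupp.single F.1 r (insert a B) else 0) =
          0 := by
        split_ifs with ha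
        · rfl
        · rw [Finsupp.single_eq_of_ne (fun e => h' ⟨ha, e.symm⟩), mul_zero]
      rw [e1, e2]

theorem IsAcyclicAt.reducedHomologyVanishes (hK : ∀ F ∈ K, ∀ G ⊆ F, G ∈ K) {j : ℕ}
    (h : IsAcyclicAt k K j) : reducedHomologyVanishes k K ((j : ℤ) - 1) := by
  have key : ∀ z : chainGroup k K j, chainBoundary (chainFun z) = 0 →
      ∃ b, boundary k K j b = z := by
    intro z hz
    obtain ⟨b, hb, hbz⟩ := h _ (isFaceChain_chainFun z) hz
    obtain ⟨x, rfl⟩ := exists_chainFun_eq hb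
    exact ⟨x, chainFun_injective (by rw [chainFun_boundary hK, hbz])⟩
  rw [SerrePaper.reducedHomologyVanishes, if_neg (by omega)]
  cases j with
  | zero =>
    rw [if_pos (by simp)]
    refine fun z => key z ?_
    funext B
    refine Finset.sum_eq_zero fun a _ => ?_
    by_contra hne
    have := (isFaceChain_chainFun z _ (right_ne_zero_of_mul hne)).2
    simp at this
  | succ p =>
    have hp : ((p + 1 : ℕ) : ℤ) - 1 = p := by simp
    rw [if_neg (by omega), hp]
    intro z hz
    refine key z ?_
    refine (chainFun_boundary hK (j := p) z).symm.trans ((congrArg chainFun hz).trans ?_)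
    funext B
    simp [chainFun]

theorem card_le_modDim_extM (h0 : ∅ ∈ K) (hK : ∀ F ∈ K, ∀ G ⊆ F, G ∈ K) {F : Finset V} {j : ℕ}
    (h : ¬ IsAcyclicAt k (link K F) j) {i : ℕ} (hi : i + j + F.card = Fintype.card V) :
    (F.card : WithBot ℕ∞) ≤
      modDim (extM (srRing k K) (ModuleCat.of _ (MvPolynomial V k)) i) := by
  simp only [IsAcyclicAt, not_forall, not_exists, not_and] at h
  obtain ⟨c, hc, hcyc, hnb⟩ := h
  have hdim : ringKrullDim (MvPolynomial F k) = F.card := by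
    rw [MvPolynomial.ringKrullDim_of_isNoetherianRing, ringKrullDim_eq_zero_of_field]
    simp
  rw [← hdim, modDim]
  refine ringKrullDim_le_of_surjective (Ideal.Quotient.lift _ (killCompl k F).toRingHom
    fun f hf => killCompl_eq_zero h0 hK hc hcyc hnb hi hf) ?_
  exact Ideal.Quotient.lift_surjective_of_surjective _ _ (killCompl_surjective F)

theorem exists_link_not_isAcyclicAt (hK : ∀ F ∈ K, ∀ G ⊆ F, G ∈ K) {i j : ℕ}
    (h : bettiNonzero k K i (i + j)) :
    ∃ F : Finset V, F.card + (i + j) ≤ Fintype.card V ∧ ¬ IsAcyclicAt k (link K F) j := by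
  obtain ⟨W, hW, hne⟩ := h
  by_contra! hall
  have hW' : inducedSub K W = {G ∈ K | Disjoint G Wᶜ} := by
    ext G
    rw [inducedSub, Set.mem_ofPred_eq, Set.mem_ofPred_eq, ← le_compl_iff_disjoint_right,
      compl_compl]
  have hac : IsAcyclicAt k (inducedSub K W) j := by
    rw [hW']
    refine IsAcyclicAt.of_link _ hK fun F hF => hall F ?_
    have := Finset.card_le_card hF
    have hWn := Finset.card_le_univ W
    rw [Finset.card_compl] at this
    omega
  refine hne ?_
  have hij : ((i + j : ℕ) : ℤ) - i - 1 = j - 1 := by push_cast; ring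
  rw [hij]
  have hdown : ∀ F ∈ inducedSub K W, ∀ G ⊆ F, G ∈ inducedSub K W :=
    fun F hF G hG => ⟨hK F hF.1 G hG, hG.trans hF.2⟩
  exact hac.reducedHomologyVanishes hdown

end Resolution

/-- Theorem `length-mfr`: for a pure simplicial complex `Δ` on `[n]`
and `r ≥ 2`, the maximal length of the linear strands of slope `j < r` of the minimal
graded free resolution of `k[Δ]` is at most `n - S_r-depth(k[Δ])`:
`max{ i : β_{i,i+j}(k[Δ]) ≠ 0 for some j < r } ≤ n - S_r-depth(k[Δ])`. -/
theorem linear_strand_length_le_sub_serreDepth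
    (k : Type) [Field k] (n r : ℕ) (hr : 2 ≤ r)
    (K : Set (Finset (Fin n))) (hK : IsComplex K) (hpure : Pure K) :
    ∀ i j : ℕ, j < r → bettiNonzero k K i (i + j) →
      (i : ℤ) ≤ (n : ℤ) - serreDepth k r (srRing k K) := by
  intro i j hj hb
  obtain ⟨⟨G, hG⟩, hdown⟩ := hK
  have h0 : ∅ ∈ K := hdown G hG _ (Finset.empty_subset G)
  obtain ⟨F, hF, hac⟩ := exists_link_not_isAcyclicAt hdown hb
  rw [Fintype.card_fin] at hF
  have hle : serreDepth k r (srRing k K) ≤ j + F.card := by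
    refine Nat.sInf_le ?_
    have h1 : n - (j + F.card) + j + F.card = Fintype.card (Fin n) := by
      rw [Fintype.card_fin]; omega
    have h2 := card_le_modDim_extM h0 hdown hac h1
    rw [Set.mem_ofPred_eq, serreK, Nat.card_eq_fintype_card, Fintype.card_fin]
    refine le_trans ?_ h2
    exact_mod_cast (by omega : j + F.card + 1 - r ≤ F.card)
  omega

end SerrePaper
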